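/- Let D ⊆ ℂ^{n+m} be a C^k-smooth strongly linearly convex bounded domain with defining function ρ, k ≥ 2, let π : ℂ^{n+m} → ℂⁿ be the projection onto the first n coordinates, let z ∈ ∂π(D), and let (z,w) ∈ ∂D be a point over z with (∂ρ/∂w_j)(z,w) = 0 for all j = 1,…,m. Then for every C¹ defining function ρ̃ of the shadow π(D) near z, the complex tangent spaces satisfy T^ℂ_z ∂π(D) × ℂᵐ = T^ℂ_{(z,w)} ∂D, i.e. {X ∈ ℂⁿ : Σ_j (∂ρ̃/∂z_j)(z)·X_j = 0} × ℂᵐ = {(X,Y) ∈ ℂⁿ × ℂᵐ : Σ_j (∂ρ/∂z_j)(z,w)·X_j + Σ_j (∂ρ/∂w_j)(z,w)·Y_j = 0}. -/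

import Mathlib

open Set Topology Filter

noncomputable section

variable {E : Type*} [NormedAddCommGroup E] [NormedSpace ℂ E]

/-- A complex affine line in a complex normed space. -/
def IsComplexAffineLine (L : Set E) : Prop :=
  ∃ a v : E, v ≠ 0 ∧ L = {x | ∃ t : ℂ, x = a + t • v}

/-- A complex affine hyperplane: a level set of a nonzero continuous ℂ-linear functional. -/
def IsComplexAffineHyperplane (H : Set E) : Prop :=
  ∃ (f : E →L[ℂ] ℂ) (c : ℂ), f ≠ 0 ∧ H = {x | f x = c}

/-- A domain `D` is ℂ-convex if its intersection with every complex affine line meeting it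
is connected and simply connected. -/
def IsCConvex (D : Set E) : Prop :=
  ∀ L : Set E, IsComplexAffineLine L → (L ∩ D).Nonempty →
    IsConnected (L ∩ D) ∧ SimplyConnectedSpace ↥(L ∩ D)

/-- `p` is an extreme ℂ-convex boundary point of `D`. -/
def ExtremeCConvexAt (D : Set E) (p : E) : Prop :=
  ∃ H : Set E, IsComplexAffineHyperplane H ∧ p ∈ H ∧
    ∃ U : Set E, IsOpen U ∧ p ∈ U ∧ H ∩ closure D ∩ U = {p}

/-- `p` is a globally extreme ℂ-convex boundary point of `D`. -/
def GloballyExtremeCConvexAt (D : Set E) (p : E) : Prop :=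
  ∃ H : Set E, IsComplexAffineHyperplane H ∧ p ∈ H ∧ H ∩ closure D = {p}

/-- `p` is a strictly ℂ-convex boundary point of `D`. -/
def StrictlyCConvexAt (D : Set E) (p : E) : Prop :=
  ∃ U : Set E, IsOpen U ∧ p ∈ U ∧
    ∀ H : Set E, IsComplexAffineHyperplane H → p ∈ H → H ∩ D = ∅ →
      U ∩ closure D ∩ H = {p}

/-- `p` is a globally strictly ℂ-convex boundary point of `D`. -/
def GloballyStrictlyCConvexAt (D : Set E) (p : E) : Prop :=
  ∀ H : Set E, IsComplexAffineHyperplane H → p ∈ H → H ∩ D = ∅ →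
    closure D ∩ H = {p}

/-- `p` is a normal boundary point of `D`. -/
def NormalAt (D : Set E) (p : E) : Prop :=
  ∀ U : Set E, IsOpen U → p ∈ U →
    ∃ V : Set E, IsOpen V ∧ p ∈ V ∧ V ⊆ U ∧
      ∀ x ∈ V ∩ D, ∀ y ∈ V ∩ D, JoinedIn (U ∩ D) x y

/-- `p` is a strongly normal boundary point of `D`. -/
def StronglyNormalAt (D : Set E) (p : E) : Prop :=
  ∀ U : Set E, IsOpen U → p ∈ U →
    ∃ V : Set E, IsOpen V ∧ p ∈ V ∧ V ⊆ U ∧ IsConnected (V ∩ D)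

/-- The Wirtinger-type derivative `∂ρ(z)(X) = (dρ(z)(X) - i·dρ(z)(iX))/2` of a real-valued
function; for `ρ` real-valued this is the complex-linear part of the real differential, so that
`∂ρ(z)(X) = Σ_j (∂ρ/∂z_j)(z)·X_j` in coordinates. -/
def wirtingerDeriv (ρ : E → ℝ) (z X : E) : ℂ :=
  (((fderiv ℝ ρ z X : ℝ) : ℂ) - Complex.I * ((fderiv ℝ ρ z (Complex.I • X) : ℝ) : ℂ)) / 2

/-- The second (real) derivative `D²ρ(z)(X,Y)`. -/
def secondDerivAt (ρ : E → ℝ) (z X Y : E) : ℝ :=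
  fderiv ℝ (fderiv ℝ ρ) z X Y

/-- `U`, `ρ`, `c` witness that the bounded domain `D` is a `C^k`-smooth strongly linearly
convex domain. -/
def IsSLCDefiningData (k : ℕ∞) (D U : Set E) (ρ : E → ℝ) (c : ℝ) : Prop :=
  IsOpen U ∧ frontier D ⊆ U ∧ ContDiffOn ℝ k ρ U ∧
  frontier D = {z ∈ U | ρ z = 0} ∧ D ∩ U = {z ∈ U | ρ z < 0} ∧
  (∀ z ∈ U, fderiv ℝ ρ z ≠ 0) ∧ 0 < c ∧
  (∀ z ∈ frontier D, ∀ X : E, wirtingerDeriv ρ z X = 0 →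
    c * ‖X‖ ^ 2 ≤ secondDerivAt ρ z X X)

end

/-- If `g ≤ 0` wherever `f < 0`, and `f ≠ 0`, then `g` is a multiple of `f`. -/
theorem exists_eq_smul_of_neg_imp_nonpos {F : Type*} [NormedAddCommGroup F] [NormedSpace ℝ F]
    {f g : F →L[ℝ] ℝ} (hf : f ≠ 0) (h : ∀ x, f x < 0 → g x ≤ 0) : ∃ a : ℝ, g = a • f := by
  obtain ⟨v, hv⟩ : ∃ v, f v < 0 := by
    obtain ⟨u, hu⟩ := ContinuousLinearMap.exists_ne_zero hf
    rcases lt_or_gt_of_ne hu with hu | hu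
    · exact ⟨u, hu⟩
    · exact ⟨-u, by simpa using hu⟩
  have hker : ∀ x, f x = 0 → g x = 0 := by
    intro x hx
    by_contra hg
    have := h (v + ((1 - g v) / g x) • x) (by simpa [hx] using hv)
    simp only [map_add, map_smul, smul_eq_mul, div_mul_cancel₀ _ hg] at this
    linarith
  refine ⟨g v / f v, ContinuousLinearMap.ext fun x => ?_⟩
  have := hker (x - (f x / f v) • v) (by simp [hv.ne])
  simp only [map_sub, map_smul, smul_eq_mul, sub_eq_zero] at this
  simp only [smul_apply, smul_eq_mul, this]
  ring

/-- A function with negative derivative in direction `v` decreases along `v` for small times. -/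
theorem HasFDerivAt.eventually_lt_of_neg {F : Type*} [NormedAddCommGroup F] [NormedSpace ℝ F]
    {f : F → ℝ} {f' : F →L[ℝ] ℝ} {x : F} (hf : HasFDerivAt f f' x) {v : F} (hv : f' v < 0) :
    ∀ᶠ t : ℝ in 𝓝[>] 0, f (x + t • v) < f x := by
  have hslope := (hf.hasLineDerivAt v).tendsto_slope_zero_right
  filter_upwards [hslope.eventually_lt_const hv, self_mem_nhdsWithin] with t ht ht0
  rw [smul_eq_mul] at ht
  exact sub_neg.mp ((pos_iff_neg_of_mul_neg ht).mp (inv_pos.mpr ht0))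

theorem fderiv_eq_zero_of_wirtingerDeriv_eq_zero {E : Type*} [NormedAddCommGroup E]
    [NormedSpace ℂ E] {ρ : E → ℝ} {z X : E} (h : wirtingerDeriv ρ z X = 0) :
    fderiv ℝ ρ z X = 0 ∧ fderiv ℝ ρ z (Complex.I • X) = 0 := by
  have h' := (div_eq_zero_iff.mp h).resolve_right two_ne_zero
  constructor
  · simpa using congrArg Complex.re h'
  · simpa using congrArg Complex.im h'

theorem fderiv_inr_eq_zero_of_wirtingerDeriv_single {E : Type*} [NormedAddCommGroup E]
    [NormedSpace ℂ E] {m : ℕ} {ρ : E × EuclideanSpace ℂ (Fin m) → ℝ}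
    {p : E × EuclideanSpace ℂ (Fin m)}
    (h : ∀ j, wirtingerDeriv ρ p (0, EuclideanSpace.single j 1) = 0)
    (Y : EuclideanSpace ℂ (Fin m)) : fderiv ℝ ρ p (0, Y) = 0 := by
  have hY : ((0 : E), Y) = ∑ j, ((Y j).re • ((0 : E), EuclideanSpace.single j (1 : ℂ)) +
      (Y j).im • Complex.I • ((0 : E), EuclideanSpace.single j (1 : ℂ))) := by
    ext i
    · simp [Prod.fst_sum]
    · simp [Prod.snd_sum, Pi.single_apply, Finset.sum_add_distrib, Complex.re_add_im]
  rw [hY, map_sum]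
  refine Finset.sum_eq_zero fun j _ => ?_
  obtain ⟨h1, h2⟩ := fderiv_eq_zero_of_wirtingerDeriv_eq_zero (h j)
  rw [map_add, map_smul, map_smul, h1, h2, smul_zero, smul_zero, add_zero]

/-- Let `D ⊆ ℂ^{n+m} = ℂⁿ × ℂᵐ` be a `C^k`-smooth strongly linearly convex bounded domain
with defining function `ρ`, `k ≥ 2`, let `π = Prod.fst`, let `z ∈ ∂π(D)`, and let
`(z,w) ∈ ∂D` be a point over `z` with `(∂ρ/∂w_j)(z,w) = 0` for all `j`. Then for every
`C¹` defining function `ρ̃` of the shadow `π(D)` near `z`, the complex tangent spaces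
satisfy `T^ℂ_z ∂π(D) × ℂᵐ = T^ℂ_{(z,w)} ∂D`, i.e.
`{X : Σ_j (∂ρ̃/∂z_j)(z)·X_j = 0} × ℂᵐ = {(X,Y) : Σ_j (∂ρ/∂z_j)(z,w)·X_j + Σ_j (∂ρ/∂w_j)(z,w)·Y_j = 0}`. -/
theorem shadow_complex_tangent_space {n m : ℕ} (k : ℕ∞) (hk : 2 ≤ k)
    (D : Set (EuclideanSpace ℂ (Fin n) × EuclideanSpace ℂ (Fin m)))
    (hOpen : IsOpen D) (hConn : IsConnected D) (hBdd : Bornology.IsBounded D)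
    (U : Set (EuclideanSpace ℂ (Fin n) × EuclideanSpace ℂ (Fin m)))
    (ρ : EuclideanSpace ℂ (Fin n) × EuclideanSpace ℂ (Fin m) → ℝ) (c : ℝ)
    (hSLC : IsSLCDefiningData k D U ρ c)
    (z : EuclideanSpace ℂ (Fin n)) (hz : z ∈ frontier (Prod.fst '' D))
    (w : EuclideanSpace ℂ (Fin m)) (hzw : (z, w) ∈ frontier D)
    (hw : ∀ j : Fin m, wirtingerDeriv ρ (z, w) (0, EuclideanSpace.single j 1) = 0)
    (Ut : Set (EuclideanSpace ℂ (Fin n))) (ρt : EuclideanSpace ℂ (Fin n) → ℝ)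
    (hUt : IsOpen Ut) (hzUt : z ∈ Ut)
    (hρt : ContDiffOn ℝ 1 ρt Ut)
    (hdt : ∀ x ∈ Ut, fderiv ℝ ρt x ≠ 0)
    (hzerot : frontier (Prod.fst '' D) ∩ Ut = {x ∈ Ut | ρt x = 0})
    (hnegt : (Prod.fst '' D) ∩ Ut = {x ∈ Ut | ρt x < 0}) :
    {X : EuclideanSpace ℂ (Fin n) |
        ∑ j, wirtingerDeriv ρt z (EuclideanSpace.single j 1) * X j = 0} ×ˢ
      (Set.univ : Set (EuclideanSpace ℂ (Fin m))) =
    {P : EuclideanSpace ℂ (Fin n) × EuclideanSpace ℂ (Fin m) |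
        (∑ j, wirtingerDeriv ρ (z, w) (EuclideanSpace.single j 1, 0) * P.1 j) +
        (∑ j, wirtingerDeriv ρ (z, w) (0, EuclideanSpace.single j 1) * P.2 j) = 0} := by
  obtain ⟨hU, hfrU, hρ, hzero, hneg, hd, -, -⟩ := hSLC
  have hpU : (z, w) ∈ U := hfrU hzw
  have hρd : HasFDerivAt ρ (fderiv ℝ ρ (z, w)) (z, w) :=
    ((hρ.contDiffAt (hU.mem_nhds hpU)).differentiableAt fun h0 => by
      have : k = 0 := by exact_mod_cast h0
      simp [this] at hk).hasFDerivAt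
  have hρtd : HasFDerivAt ρt (fderiv ℝ ρt z) z :=
    ((hρt.contDiffAt (hUt.mem_nhds hzUt)).differentiableAt one_ne_zero).hasFDerivAt
  have hρ0 : ρ (z, w) = 0 := (hzero.subset hzw).2
  have hρt0 : ρt z = 0 := (hzerot.subset ⟨hz, hzUt⟩).2
  have hinr := fderiv_inr_eq_zero_of_wirtingerDeriv_single hw
  set A := (fderiv ℝ ρ (z, w)).comp (ContinuousLinearMap.inl ℝ (EuclideanSpace ℂ (Fin n))
    (EuclideanSpace ℂ (Fin m)))
  have hAX : ∀ X, A X = fderiv ℝ ρ (z, w) (X, 0) := fun X => rfl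
  have hA0 : A ≠ 0 := by
    refine fun h => hd _ hpU (ContinuousLinearMap.ext fun P => ?_)
    have hP : P = (P.1, 0) + (0, P.2) := by simp
    rw [hP, map_add, hinr, ← hAX, h]
    simp
  have hle : ∀ X, A X < 0 → fderiv ℝ ρt z X ≤ 0 := by
    intro X hX
    by_contra! hpos
    have hlt := hρd.eventually_lt_of_neg (v := (X, 0)) hX
    have hgt := hρtd.neg.eventually_lt_of_neg (v := X) (by simpa using hpos)
    have hcU : ∀ᶠ t : ℝ in 𝓝[>] 0, (z, w) + t • (X, (0 : EuclideanSpace ℂ (Fin m))) ∈ U :=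
      ((Continuous.tendsto' (by fun_prop) _ _ (by simp)).mono_left
        nhdsWithin_le_nhds).eventually (hU.mem_nhds hpU)
    have hcUt : ∀ᶠ t : ℝ in 𝓝[>] 0, z + t • X ∈ Ut :=
      ((Continuous.tendsto' (by fun_prop) _ _ (by simp)).mono_left
        nhdsWithin_le_nhds).eventually (hUt.mem_nhds hzUt)
    obtain ⟨t, h1, h2, h3, h4⟩ := (hlt.and (hgt.and (hcU.and hcUt))).exists
    have hD := (hneg.superset ⟨h3, hρ0 ▸ h1⟩).1
    have := (hnegt.subset ⟨⟨_, hD, rfl⟩, h4⟩).2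
    simp only [Pi.neg_apply, hρt0, neg_zero, neg_lt_zero] at h2
    exact lt_asymm this h2
  obtain ⟨a, ha⟩ := exists_eq_smul_of_neg_imp_nonpos hA0 hle
  have ha0 : a ≠ 0 := by
    rintro rfl
    exact hdt z hzUt (by simpa using ha)
  have hwd : ∀ X, wirtingerDeriv ρt z X = a * wirtingerDeriv ρ (z, w) (X, 0) := by
    intro X
    simp only [wirtingerDeriv, ha, smul_apply, smul_eq_mul, hAX,
      Prod.smul_mk, smul_zero, Complex.ofReal_mul]
    ring
  ext P
  simp [hw, hwd, mul_assoc, ← Finset.mul_sum, ha0]
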